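/- Let ξ > 0 satisfy ξ·ζ(1+ξ) ≥ 2 (i.e. ξ ≥ α₀, where α₀ is the unique positive solution of 2 = α·ζ(1+α)), and let c ∈ ℂ with Re c = 1/2 + ξ. Then for every square-summable sequence (a_n)_{n≥1} of complex numbers, ∑_{k=0}^∞ (ξ^{2k}/(k!)²)·|∑_{n=1}^∞ a_n (−log n)^k n^{−c}|² ≤ ((ζ(1+2ξ) + ζ(1+ξ))/2)·∑_{n=1}^∞ |a_n|². -/

import Mathlib

/-- ζ(σ) = ∑_{n=1}^∞ n^{−σ} for real σ. -/
noncomputable def zetaR (σ : ℝ) : ℝ := ∑' n : ℕ, ((n : ℝ) + 1) ^ (-σ)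

open Finset Filter Topology

/-- The Poisson weight `e^{-u} u^k / k!`. -/
noncomputable def poissonWeight (k : ℕ) (u : ℝ) : ℝ := Real.exp (-u) * (u ^ k / k.factorial)

lemma poissonWeight_nonneg (k : ℕ) {u : ℝ} (hu : 0 ≤ u) : 0 ≤ poissonWeight k u := by
  unfold poissonWeight; positivity

lemma hasDerivAt_pow_succ_div_factorial (k : ℕ) (u : ℝ) :
    HasDerivAt (fun u : ℝ => u ^ (k + 1) / ((k + 1).factorial : ℝ)) (u ^ k / k.factorial) u := by
  have h := (hasDerivAt_pow (k + 1) u).div_const ((k + 1).factorial : ℝ)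
  refine h.congr_deriv ?_
  have : (k.factorial : ℝ) ≠ 0 := by positivity
  have : (k : ℝ) + 1 ≠ 0 := by positivity
  rw [Nat.factorial_succ]
  push_cast
  field_simp

lemma hasDerivAt_exp_neg (u : ℝ) : HasDerivAt (fun u : ℝ => Real.exp (-u)) (-Real.exp (-u)) u := by
  simpa using (hasDerivAt_neg u).exp

lemma hasDerivAt_poissonWeight_succ (k : ℕ) (u : ℝ) :
    HasDerivAt (poissonWeight (k + 1)) (poissonWeight k u - poissonWeight (k + 1) u) u := by
  have h := (hasDerivAt_exp_neg u).mul (hasDerivAt_pow_succ_div_factorial k u)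
  refine h.congr_deriv ?_
  simp only [poissonWeight]
  ring

lemma hasDerivAt_sum_poissonWeight (k : ℕ) (u : ℝ) :
    HasDerivAt (fun u => ∑ j ∈ range (k + 1), poissonWeight j u) (-poissonWeight k u) u := by
  induction k with
  | zero =>
    simpa [poissonWeight] using hasDerivAt_exp_neg u
  | succ k ih =>
    simp_rw [sum_range_succ _ (k + 1)]
    exact (ih.add (hasDerivAt_poissonWeight_succ k u)).congr_deriv (by ring)

lemma poissonWeight_sub_succ (k : ℕ) (u : ℝ) :
    poissonWeight k u - poissonWeight (k + 1) u =
      Real.exp (-u) * (u ^ k / (k + 1).factorial) * ((k + 1 : ℕ) - u) := by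
  have : (k.factorial : ℝ) ≠ 0 := by positivity
  have : (k : ℝ) + 1 ≠ 0 := by positivity
  simp only [poissonWeight, Nat.factorial_succ]
  push_cast
  field_simp
  ring

lemma monotoneOn_poissonWeight (k : ℕ) : MonotoneOn (poissonWeight k) (Set.Icc 0 (k : ℝ)) := by
  cases k with
  | zero => simp
  | succ k =>
    have hd := hasDerivAt_poissonWeight_succ k
    refine monotoneOn_of_deriv_nonneg (convex_Icc _ _)
      (fun x _ => (hd x).continuousAt.continuousWithinAt)
      (fun x _ => (hd x).differentiableAt.differentiableWithinAt) fun x hx => ?_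
    rw [interior_Icc] at hx
    rw [(hd x).deriv, poissonWeight_sub_succ]
    have := hx.1.le
    exact mul_nonneg (by positivity) (sub_nonneg.2 hx.2.le)

lemma antitoneOn_poissonWeight (k : ℕ) : AntitoneOn (poissonWeight k) (Set.Ici (k : ℝ)) := by
  cases k with
  | zero =>
    intro x _ y _ hxy
    simpa [poissonWeight] using hxy
  | succ k =>
    have hd := hasDerivAt_poissonWeight_succ k
    refine antitoneOn_of_deriv_nonpos (convex_Ici _)
      (fun x _ => (hd x).continuousAt.continuousWithinAt)
      (fun x _ => (hd x).differentiableAt.differentiableWithinAt) fun x hx => ?_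
    rw [interior_Ici] at hx
    rw [(hd x).deriv, poissonWeight_sub_succ]
    have h0 : (0 : ℝ) ≤ x := (Nat.cast_nonneg (k + 1)).trans hx.le
    exact mul_nonpos_of_nonneg_of_nonpos (by positivity) (sub_nonpos.2 hx.le)

lemma poissonWeight_self_le (k : ℕ) :
    poissonWeight (k + 1) ((k + 1 : ℕ) : ℝ) ≤ Real.exp (-1) := by
  induction k with
  | zero => simp [poissonWeight]
  | succ k ih =>
    refine le_trans ?_ ih
    have hk : (0 : ℝ) < (k : ℝ) + 1 := by positivity
    have h1 : ((k : ℝ) + 2) ^ (k + 1) ≤ ((k : ℝ) + 1) ^ (k + 1) * Real.exp 1 := by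
      have h2 : ((k : ℝ) + 2) ≤ ((k : ℝ) + 1) * Real.exp (1 / (k + 1)) := by
        have := Real.add_one_le_exp (1 / ((k : ℝ) + 1))
        calc (k : ℝ) + 2 = (k + 1) * (1 / ((k : ℝ) + 1) + 1) := by field_simp; ring
          _ ≤ _ := by gcongr
      calc ((k : ℝ) + 2) ^ (k + 1) ≤ (((k : ℝ) + 1) * Real.exp (1 / (k + 1))) ^ (k + 1) := by
            gcongr
        _ = _ := by
            rw [mul_pow, ← Real.exp_nat_mul]
            push_cast
            congr 2
            field_simp
    have hf : (0 : ℝ) < (k + 1).factorial := by positivity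
    simp only [poissonWeight, Nat.factorial_succ (k + 1)]
    push_cast
    have e : Real.exp (-((k : ℝ) + 1)) = Real.exp (-((k : ℝ) + 1 + 1)) * Real.exp 1 := by
      rw [← Real.exp_add]; ring_nf
    rw [e, mul_assoc]
    gcongr
    rw [show (k : ℝ) + 1 + 1 = k + 2 by ring, pow_succ _ (k + 1), div_le_iff₀ (by positivity)]
    calc ((k : ℝ) + 2) ^ (k + 1) * (k + 2)
        ≤ (((k : ℝ) + 1) ^ (k + 1) * Real.exp 1) * (k + 2) := by gcongr
      _ = _ := by field_simp

lemma poissonWeight_le {k : ℕ} (hk : k ≠ 0) {u : ℝ} (hu : 0 ≤ u) :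
    poissonWeight k u ≤ Real.exp (-1) := by
  obtain ⟨k, rfl⟩ := Nat.exists_eq_succ_of_ne_zero hk
  refine le_trans ?_ (poissonWeight_self_le k)
  have h0 : (0 : ℝ) ≤ ((k + 1 : ℕ) : ℝ) := Nat.cast_nonneg _
  rcases le_total u ((k + 1 : ℕ) : ℝ) with h | h
  · exact monotoneOn_poissonWeight (k + 1) ⟨hu, h⟩ ⟨h0, le_rfl⟩ h
  · exact antitoneOn_poissonWeight (k + 1) (Set.mem_Ici.2 le_rfl) h h

/-- A unimodal function is dominated on an interval of length one by the increment of a primitive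
plus the increment of its increasing part. -/
lemma le_primitive_sub_add_sub {f F : ℝ → ℝ} {p a : ℝ} (ha : 1 ≤ a) (hp : 1 ≤ p)
    (hF : ∀ x, 1 ≤ x → HasDerivAt F (f x) x) (hmono : MonotoneOn f (Set.Icc 1 p))
    (hanti : AntitoneOn f (Set.Ici p)) :
    f (a + 1) ≤ F (a + 1) - F a + (f (min (a + 1) p) - f (min a p)) := by
  obtain ⟨x, ⟨hx1, hx2⟩, hx⟩ := exists_hasDerivAt_eq_slope F f (lt_add_one a)
    (fun x hx => (hF x (ha.trans hx.1)).continuousAt.continuousWithinAt)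
    (fun x hx => hF x (ha.trans hx.1.le))
  have e : F (a + 1) - F a = f x := by rw [hx]; simp
  rw [e]
  have hmin : f (min a p) ≤ f (min (a + 1) p) :=
    hmono ⟨le_min ha hp, min_le_right _ _⟩ ⟨le_min (by linarith) hp, min_le_right _ _⟩
      (min_le_min_right _ (by linarith))
  rcases le_total x p with h | h
  · have h1 : f (min a p) ≤ f x := by
      rw [min_eq_left (hx1.le.trans h)]
      exact hmono ⟨ha, hx1.le.trans h⟩ ⟨ha.trans hx1.le, h⟩ hx1.le
    have h2 : f (a + 1) ≤ f (min (a + 1) p) := by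
      rcases le_total (a + 1) p with h' | h'
      · rw [min_eq_left h']
      · rw [min_eq_right h']
        exact hanti (Set.mem_Ici.2 le_rfl) h' h'
    linarith
  · have : f (a + 1) ≤ f x := hanti h (h.trans hx2.le) hx2.le
    linarith

lemma sum_le_of_unimodal {f F : ℝ → ℝ} {p a : ℝ} (ha : 1 ≤ a) (hp : 1 ≤ p)
    (hF : ∀ x, 1 ≤ x → HasDerivAt F (f x) x) (hmono : MonotoneOn f (Set.Icc 1 p))
    (hanti : AntitoneOn f (Set.Ici p)) (hF0 : ∀ x, 1 ≤ x → F x ≤ 0) (N : ℕ) :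
    ∑ i ∈ range N, f (a + i + 1) ≤ -F a + (f p - f (min a p)) := by
  have key : ∑ i ∈ range N, f (a + i + 1) ≤
      F (a + N) - F a + (f (min (a + N) p) - f (min a p)) := by
    induction N with
    | zero => simp
    | succ N ih =>
      rw [sum_range_succ]
      have h := le_primitive_sub_add_sub (a := a + N)
        (ha.trans (le_add_of_nonneg_right (Nat.cast_nonneg N))) hp hF hmono hanti
      push_cast
      rw [← add_assoc]
      linarith
  have haN : 1 ≤ a + N := ha.trans (le_add_of_nonneg_right (Nat.cast_nonneg N))
  have h1 := hF0 _ haN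
  have h2 : f (min (a + N) p) ≤ f p :=
    hmono ⟨le_min haN hp, min_le_right _ _⟩ ⟨hp, le_rfl⟩ (min_le_right _ _)
  linarith

lemma poissonWeight_log_div (k : ℕ) {ξ x : ℝ} (hξ : 0 < ξ) (hx : 0 < x) :
    poissonWeight k (ξ * Real.log x) / x =
      (ξ / (1 + ξ)) ^ k * poissonWeight k ((1 + ξ) * Real.log x) := by
  have h : Real.exp (-((1 + ξ) * Real.log x)) = Real.exp (-(ξ * Real.log x)) / x := by
    rw [show -((1 + ξ) * Real.log x) = -(ξ * Real.log x) - Real.log x by ring, Real.exp_sub,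
      Real.exp_log hx]
  simp only [poissonWeight, h, mul_pow, div_pow]
  field_simp

lemma sum_poissonWeight_log_div_le (k : ℕ) {ξ a : ℝ} (hξ : 0 < ξ) (ha : 1 ≤ a) (N : ℕ) :
    ∑ i ∈ range N, poissonWeight k (ξ * Real.log (a + i + 1)) / (a + i + 1) ≤
      (1 / ξ) * ∑ j ∈ range (k + 1), poissonWeight j (ξ * Real.log a) +
      ((ξ / (1 + ξ)) ^ k * poissonWeight k k -
        poissonWeight k (ξ * Real.log (min a (Real.exp (k / (1 + ξ))))) /
          min a (Real.exp (k / (1 + ξ)))) := by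
  have h1ξ : 0 < 1 + ξ := by linarith
  set p := Real.exp (k / (1 + ξ)) with hpdef
  have hp : 1 ≤ p := Real.one_le_exp (by positivity)
  have hlogp : (1 + ξ) * Real.log p = k := by
    rw [hpdef, Real.log_exp]; field_simp
  have hmono : MonotoneOn (fun x => poissonWeight k (ξ * Real.log x) / x) (Set.Icc 1 p) := by
    intro x hx y hy hxy
    have hx0 : 0 < x := by linarith [hx.1]
    have hy0 : 0 < y := by linarith [hy.1]
    simp only [poissonWeight_log_div k hξ hx0, poissonWeight_log_div k hξ hy0]
    have hl := Real.log_le_log hx0 hxy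
    have hl0 := Real.log_nonneg hx.1
    have hlp : (1 + ξ) * Real.log y ≤ k := by
      rw [← hlogp]
      exact mul_le_mul_of_nonneg_left (Real.log_le_log hy0 hy.2) h1ξ.le
    have hxy' := mul_le_mul_of_nonneg_left hl h1ξ.le
    have hx1 : 0 ≤ (1 + ξ) * Real.log x := by positivity
    exact mul_le_mul_of_nonneg_left
      (monotoneOn_poissonWeight k ⟨hx1, hxy'.trans hlp⟩ ⟨hx1.trans hxy', hlp⟩ hxy')
      (by positivity)
  have hanti : AntitoneOn (fun x => poissonWeight k (ξ * Real.log x) / x) (Set.Ici p) := by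
    intro x hx y hy hxy
    have hp0 : 0 < p := by linarith
    have hx0 : 0 < x := hp0.trans_le hx
    have hy0 : 0 < y := hp0.trans_le hy
    simp only [poissonWeight_log_div k hξ hx0, poissonWeight_log_div k hξ hy0]
    have hlp : (k : ℝ) ≤ (1 + ξ) * Real.log x := by
      rw [← hlogp]
      exact mul_le_mul_of_nonneg_left (Real.log_le_log hp0 hx) h1ξ.le
    have hxy' := mul_le_mul_of_nonneg_left (Real.log_le_log hx0 hxy) h1ξ.le
    exact mul_le_mul_of_nonneg_left (antitoneOn_poissonWeight k hlp (hlp.trans hxy') hxy')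
      (by positivity)
  have hF : ∀ x : ℝ, 1 ≤ x → HasDerivAt
      (fun x => -(1 / ξ) * ∑ j ∈ range (k + 1), poissonWeight j (ξ * Real.log x))
      (poissonWeight k (ξ * Real.log x) / x) x := by
    intro x hx
    have hx0 : x ≠ 0 := by linarith
    have h := ((hasDerivAt_sum_poissonWeight k (ξ * Real.log x)).comp x
      ((Real.hasDerivAt_log hx0).const_mul ξ)).const_mul (-(1 / ξ))
    refine h.congr_deriv ?_
    field_simp
  have h := sum_le_of_unimodal ha hp hF hmono hanti (fun x hx => by
    have h0 : 0 ≤ ξ * Real.log x := mul_nonneg hξ.le (Real.log_nonneg hx)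
    have : 0 ≤ 1 / ξ * ∑ j ∈ range (k + 1), poissonWeight j (ξ * Real.log x) :=
      mul_nonneg (by positivity) (sum_nonneg fun j _ => poissonWeight_nonneg j h0)
    linarith) N
  have e : poissonWeight k (ξ * Real.log p) / p = (ξ / (1 + ξ)) ^ k * poissonWeight k k := by
    rw [poissonWeight_log_div k hξ (by linarith), hlogp]
  rw [← e]
  simpa using h

lemma exp_neg_mul_log_div {ξ x : ℝ} (hx : 0 < x) :
    Real.exp (-(ξ * Real.log x)) / x = x ^ (-(1 + ξ)) := by
  rw [Real.rpow_def_of_pos hx, show Real.log x * -(1 + ξ) = -(ξ * Real.log x) - Real.log x by ring,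
    Real.exp_sub, Real.exp_log hx]

lemma poissonWeight_log_div_eq (k : ℕ) {ξ x : ℝ} (hx : 0 < x) :
    poissonWeight k (ξ * Real.log x) / x =
      (ξ * Real.log x) ^ k / k.factorial * x ^ (-(1 + ξ)) := by
  rw [← exp_neg_mul_log_div hx, poissonWeight]
  ring

lemma summable_zetaR {σ : ℝ} (hσ : 1 < σ) : Summable fun n : ℕ => ((n : ℝ) + 1) ^ (-σ) := by
  have h := (summable_nat_add_iff 1).2 (Real.summable_nat_rpow.2 (neg_lt_neg hσ))
  simpa using h

lemma zetaR_le {ξ : ℝ} (hξ : 0 < ξ) : ξ * zetaR (1 + ξ) ≤ ξ + 2 ^ (-ξ) * (ξ / 2 + 1) := by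
  have hs := summable_zetaR (σ := 1 + ξ) (by linarith)
  have h2 : (2 : ℝ) ^ (-(1 + ξ)) = 2 ^ (-ξ) / 2 := by
    rw [show -(1 + ξ) = -ξ - 1 by ring, Real.rpow_sub_one two_ne_zero]
  have e2 : Real.exp (-(ξ * Real.log 2)) = 2 ^ (-ξ) := by
    rw [Real.rpow_def_of_pos two_pos]; congr 1; ring
  have htail : ∑' n : ℕ, ((n + 2 : ℕ) + 1 : ℝ) ^ (-(1 + ξ)) ≤ 1 / ξ * 2 ^ (-ξ) := by
    refine Real.tsum_le_of_sum_range_le (fun n => by positivity) fun N => ?_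
    have h := sum_poissonWeight_log_div_le 0 hξ one_le_two N
    simp only [fun n : ℕ => poissonWeight_log_div_eq 0 (ξ := ξ)
      (show (0 : ℝ) < 2 + n + 1 by positivity)] at h
    simp only [pow_zero, Nat.factorial_zero, Nat.cast_one, div_one, one_mul, zero_add,
      sum_range_one, poissonWeight, mul_one, e2, Nat.cast_zero, zero_div, Real.exp_zero,
      neg_zero, min_eq_right one_le_two, Real.log_one, mul_zero, sub_self, add_zero] at h
    refine le_trans (le_of_eq (sum_congr rfl fun n _ => ?_)) h
    push_cast
    ring_nf
  have hz : zetaR (1 + ξ) ≤ 1 + 2 ^ (-ξ) / 2 + 1 / ξ * 2 ^ (-ξ) := by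
    unfold zetaR
    rw [← hs.sum_add_tsum_nat_add 2, sum_range_succ, sum_range_one]
    norm_num only [Nat.cast_zero, Nat.cast_one, zero_add, Real.one_rpow, one_add_one_eq_two] at htail ⊢
    rw [h2]
    linarith
  calc ξ * zetaR (1 + ξ) ≤ ξ * (1 + 2 ^ (-ξ) / 2 + 1 / ξ * 2 ^ (-ξ)) := by gcongr
    _ = _ := by field_simp; ring

lemma lower_bound_of_two_le {ξ : ℝ} (hξ : 0 < ξ) (hα : 2 ≤ ξ * zetaR (1 + ξ)) : 1.27 < ξ := by
  have h := hα.trans (zetaR_le hξ)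
  by_contra! hlt
  rcases le_total ξ 1 with h1 | h1
  · have hb : (2 : ℝ) ^ (-ξ) ≤ 1 - ξ / 2 := by
      have h3 := rpow_one_add_le_one_add_mul_self (s := 1) (by norm_num) (p := 1 - ξ)
        (by linarith) (by linarith)
      rw [one_add_one_eq_two, Real.rpow_sub two_pos, Real.rpow_one, div_eq_mul_inv,
        ← Real.rpow_neg two_pos.le] at h3
      linarith
    nlinarith
  · have hb : (2 : ℝ) ^ (-ξ) ≤ (3 - ξ) / 4 := by
      have h3 := rpow_one_add_le_one_add_mul_self (s := 1) (by norm_num) (p := 2 - ξ)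
        (by linarith) (by linarith)
      rw [one_add_one_eq_two, Real.rpow_sub two_pos, Real.rpow_two, div_eq_mul_inv,
        ← Real.rpow_neg two_pos.le] at h3
      linarith
    nlinarith

lemma sum_log_pow_le_one {k : ℕ} (hk : k ≠ 0) {ξ : ℝ} (hξ : 1.27 < ξ) (N : ℕ) :
    ∑ n ∈ range N, (ξ * Real.log ((n : ℝ) + 1 + 1)) ^ k / k.factorial *
      ((n : ℝ) + 1 + 1) ^ (-(1 + ξ)) ≤ 1 := by
  have hξ0 : 0 < ξ := by linarith
  have h := sum_poissonWeight_log_div_le k hξ0 le_rfl N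
  have hp : 1 ≤ Real.exp (k / (1 + ξ)) := Real.one_le_exp (by positivity)
  have hsum : ∑ j ∈ range (k + 1), poissonWeight j 0 = 1 := by
    simp [sum_range_succ', poissonWeight]
  have h0 : poissonWeight k 0 = 0 := by simp [poissonWeight, hk]
  rw [min_eq_left hp, Real.log_one, mul_zero, hsum, h0] at h
  simp only [fun n : ℕ => poissonWeight_log_div_eq k (ξ := ξ)
    (show (0 : ℝ) < 1 + n + 1 by positivity)] at h
  have hmax : (ξ / (1 + ξ)) ^ k * poissonWeight k k ≤ ξ / (1 + ξ) * Real.exp (-1) :=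
    mul_le_mul (pow_le_of_le_one (by positivity) ((div_le_one (by linarith)).2 (by linarith)) hk)
      (poissonWeight_le hk (Nat.cast_nonneg k)) (poissonWeight_nonneg k (Nat.cast_nonneg k))
      (by positivity)
  have he : Real.exp (-1) ≤ 1 / 2.7 := by
    rw [Real.exp_neg, ← one_div]
    exact one_div_le_one_div_of_le (by norm_num) (by linarith [Real.exp_one_gt_d9])
  have hfin : 1 / ξ + ξ / (1 + ξ) * (1 / 2.7) ≤ 1 := by
    rw [div_add' _ _ _ hξ0.ne', div_le_one hξ0, ← sub_nonneg]
    have : ξ - (1 + ξ / (1 + ξ) * (1 / 2.7) * ξ) = (1.7 * ξ ^ 2 - 2.7) / (2.7 * (1 + ξ)) := by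
      field_simp; ring
    rw [this]
    exact div_nonneg (by nlinarith) (by positivity)
  have : ξ / (1 + ξ) * Real.exp (-1) ≤ ξ / (1 + ξ) * (1 / 2.7) := by gcongr
  simp only [add_comm (1 : ℝ) (Nat.cast _)] at h
  linarith

lemma sum_log_pow_double_le {k : ℕ} (hk : k ≠ 0) {ξ : ℝ} (hξ : 0 < ξ) (N : ℕ) :
    ∑ n ∈ range N, (ξ * Real.log ((n : ℝ) + 1 + 1)) ^ k / k.factorial *
      ((n : ℝ) + 1 + 1) ^ (-(1 + 2 * ξ)) ≤ (zetaR (1 + ξ) - 1) / 2 := by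
  have hs := summable_zetaR (σ := 1 + ξ) (by linarith)
  have hterm : ∀ n : ℕ, (ξ * Real.log ((n : ℝ) + 1 + 1)) ^ k / k.factorial *
      ((n : ℝ) + 1 + 1) ^ (-(1 + 2 * ξ)) ≤ 1 / 2 * ((n : ℝ) + 1 + 1) ^ (-(1 + ξ)) := by
    intro n
    have hx : (0 : ℝ) < (n : ℝ) + 1 + 1 := by positivity
    have hl : 0 ≤ ξ * Real.log ((n : ℝ) + 1 + 1) :=
      mul_nonneg hξ.le (Real.log_nonneg (by linarith [Nat.cast_nonneg (α := ℝ) n]))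
    have e : ((n : ℝ) + 1 + 1) ^ (-(1 + 2 * ξ)) =
        Real.exp (-(ξ * Real.log ((n : ℝ) + 1 + 1))) * ((n : ℝ) + 1 + 1) ^ (-(1 + ξ)) := by
      rw [Real.rpow_def_of_pos hx, Real.rpow_def_of_pos hx, ← Real.exp_add]
      ring_nf
    have he : Real.exp (-1) ≤ 1 / 2 := by
      rw [Real.exp_neg, ← one_div]
      exact one_div_le_one_div_of_le (by norm_num) (by linarith [Real.exp_one_gt_d9])
    rw [e, ← mul_assoc, mul_comm (_ / _) (Real.exp _)]
    exact mul_le_mul_of_nonneg_right ((poissonWeight_le hk hl).trans he) (by positivity)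
  have hz : ∑ n ∈ range N, ((n : ℝ) + 1 + 1) ^ (-(1 + ξ)) ≤ zetaR (1 + ξ) - 1 := by
    have h := hs.sum_le_tsum (range (N + 1)) (fun n _ => by positivity)
    rw [sum_range_succ'] at h
    simp only [Nat.cast_add, Nat.cast_one, Nat.cast_zero, zero_add, Real.one_rpow] at h
    unfold zetaR
    linarith
  calc _ ≤ ∑ n ∈ range N, 1 / 2 * ((n : ℝ) + 1 + 1) ^ (-(1 + ξ)) :=
        sum_le_sum fun n _ => hterm n
    _ ≤ _ := by rw [← mul_sum]; linarith

lemma one_le_zetaR {σ : ℝ} (hσ : 1 < σ) : 1 ≤ zetaR σ := by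
  have h := (summable_zetaR hσ).le_tsum 0 (fun n _ => by positivity)
  simpa [zetaR] using h

/-- Schur's test with weights `w` and `p` for a nonnegative matrix acting between `ℓ²` spaces. -/
lemma schur_test_finite {B : ℕ → ℕ → ℝ} {w p : ℕ → ℝ} {C : ℝ} (hB : ∀ k n, 0 ≤ B k n)
    (hp : ∀ n, 0 < p n) (hC : 0 ≤ C)
    (hcol : ∀ n K, ∑ k ∈ range K, w k * B k n ≤ p n)
    (hrow : ∀ k N, ∑ n ∈ range N, B k n * p n ≤ C * w k) (b : ℕ → ℝ) (K N : ℕ) :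
    ∑ k ∈ range K, (∑ n ∈ range N, B k n * b n) ^ 2 ≤ C * ∑ n ∈ range N, b n ^ 2 := by
  have hk : ∀ k, (∑ n ∈ range N, B k n * b n) ^ 2 ≤
      C * w k * ∑ n ∈ range N, B k n * (b n ^ 2 / p n) := fun k => by
    refine (sum_sq_le_sum_mul_sum_of_sq_le_mul (range N) (f := fun n => B k n * p n)
      (g := fun n => B k n * (b n ^ 2 / p n)) (fun n _ => mul_nonneg (hB k n) (hp n).le)
      (fun n _ => mul_nonneg (hB k n) (div_nonneg (sq_nonneg _) (hp n).le)) fun n _ => ?_).trans ?_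
    · have := (hp n).ne'
      exact le_of_eq (by field_simp)
    · exact mul_le_mul_of_nonneg_right (hrow k N)
        (sum_nonneg fun n _ => mul_nonneg (hB k n) (div_nonneg (sq_nonneg _) (hp n).le))
  calc _ ≤ ∑ k ∈ range K, C * w k * ∑ n ∈ range N, B k n * (b n ^ 2 / p n) :=
        sum_le_sum fun k _ => hk k
    _ = C * ∑ n ∈ range N, (b n ^ 2 / p n) * ∑ k ∈ range K, w k * B k n := by
        simp_rw [mul_sum]
        rw [sum_comm]
        exact sum_congr rfl fun n _ => sum_congr rfl fun k _ => by ring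
    _ ≤ C * ∑ n ∈ range N, (b n ^ 2 / p n) * p n := by
        gcongr with n _
        · exact div_nonneg (sq_nonneg _) (hp n).le
        · exact hcol n K
    _ = _ := by
        congr 1
        exact sum_congr rfl fun n _ => div_mul_cancel₀ _ (hp n).ne'

/-- Passage from finite sections to the full `ℓ²` bound for a complex matrix. -/
lemma tsum_norm_tsum_sq_le {B : ℕ → ℕ → ℝ} {z : ℕ → ℕ → ℂ} {b : ℕ → ℝ} {C : ℝ} (hC : 0 ≤ C)
    (hz : ∀ k n, ‖z k n‖ = B k n * b n) (hb : Summable fun n => b n ^ 2)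
    (hfin : ∀ K N, ∑ k ∈ range K, (∑ n ∈ range N, B k n * b n) ^ 2 ≤
      C * ∑ n ∈ range N, b n ^ 2) :
    ∑' k, ‖∑' n, z k n‖ ^ 2 ≤ C * ∑' n, b n ^ 2 := by
  have hfin' : ∀ K N, ∑ k ∈ range K, (∑ n ∈ range N, ‖z k n‖) ^ 2 ≤ C * ∑' n, b n ^ 2 := by
    intro K N
    simp_rw [hz]
    exact (hfin K N).trans
      (mul_le_mul_of_nonneg_left (hb.sum_le_tsum _ fun n _ => sq_nonneg _) hC)
  have hsum : ∀ k, Summable (z k) := fun k => by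
    refine Summable.of_norm (summable_of_sum_range_le (c := √(C * ∑' n, b n ^ 2))
      (fun n => norm_nonneg _) fun N => ?_)
    refine Real.le_sqrt_of_sq_le (le_trans ?_ (hfin' (k + 1) N))
    exact single_le_sum (f := fun k => (∑ n ∈ range N, ‖z k n‖) ^ 2) (fun i _ => sq_nonneg _)
      (self_mem_range_succ k)
  refine Real.tsum_le_of_sum_range_le (fun k => sq_nonneg _) fun K => ?_
  have hlim : Tendsto (fun N => ∑ k ∈ range K, ‖∑ n ∈ range N, z k n‖ ^ 2) atTop
      (𝓝 (∑ k ∈ range K, ‖∑' n, z k n‖ ^ 2)) :=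
    tendsto_finsetSum _ fun k _ => ((hsum k).hasSum.tendsto_sum_nat.norm.pow 2)
  refine le_of_tendsto' hlim fun N => le_trans ?_ (hfin' K N)
  gcongr
  exact norm_sum_le _ _

/-- Improved upper bound for φ(s) = c + ξ·2^{−s} with Re c = 1/2 + ξ and ξ·ζ(1+ξ) ≥ 2:
∑_k (ξ^{2k}/(k!)²)|f^{(k)}(c)|² ≤ ((ζ(1+2ξ)+ζ(1+ξ))/2)·∑|aₙ|². -/
theorem stmt11 (ξ : ℝ) (hξ : 0 < ξ) (hα : 2 ≤ ξ * zetaR (1 + ξ))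
    (c : ℂ) (hc : c.re = 1 / 2 + ξ)
    (a : ℕ → ℂ) (ha : Summable fun n => ‖a n‖ ^ 2) :
    ∑' k : ℕ, (ξ ^ (2 * k) / (k.factorial : ℝ) ^ 2) *
        ‖∑' n : ℕ, a n * ((-Real.log ((n : ℝ) + 1) : ℝ) : ℂ) ^ k * ((n : ℂ) + 1) ^ (-c)‖ ^ 2 ≤
      ((zetaR (1 + 2 * ξ) + zetaR (1 + ξ)) / 2) * ∑' n : ℕ, ‖a n‖ ^ 2 := by
  have hbig := lower_bound_of_two_le hξ hα
  have hz1 := one_le_zetaR (σ := 1 + ξ) (by linarith)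
  have hz2 := one_le_zetaR (σ := 1 + 2 * ξ) (by linarith)
  set C := (zetaR (1 + 2 * ξ) + zetaR (1 + ξ)) / 2 with hCdef
  have hC : 0 ≤ C := by linarith
  let x : ℕ → ℝ := fun n => (n : ℝ) + 1
  have hx : ∀ n, 0 < x n := fun n => by positivity
  have hl : ∀ n, 0 ≤ ξ * Real.log (x n) := fun n =>
    mul_nonneg hξ.le (Real.log_nonneg (by simp [x]))
  let B : ℕ → ℕ → ℝ := fun k n =>
    (ξ * Real.log (x n)) ^ k / k.factorial * x n ^ (-(1 / 2 + ξ))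
  let w : ℕ → ℝ := fun k => if k = 0 then 1 else 1 / 2
  let p : ℕ → ℝ := fun n => (1 + x n ^ ξ) / 2 * x n ^ (-(1 / 2 + ξ))
  have hB : ∀ k n, 0 ≤ B k n := fun k n => by
    have := hl n
    have := (hx n).le
    positivity
  have hp : ∀ n, 0 < p n := fun n => by
    have h1 := Real.rpow_pos_of_pos (hx n) ξ
    have h2 := Real.rpow_pos_of_pos (hx n) (-(1 / 2 + ξ))
    positivity
  have hBp : ∀ k n, B k n * p n = 1 / 2 * ((ξ * Real.log (x n)) ^ k / k.factorial *
      x n ^ (-(1 + 2 * ξ)) + (ξ * Real.log (x n)) ^ k / k.factorial * x n ^ (-(1 + ξ))) := by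
    intro k n
    have e1 : x n ^ (-(1 + 2 * ξ)) = x n ^ (-(1 / 2 + ξ)) * x n ^ (-(1 / 2 + ξ)) := by
      rw [← Real.rpow_add (hx n)]; ring_nf
    have e2 : x n ^ (-(1 + ξ)) = x n ^ ξ * (x n ^ (-(1 / 2 + ξ)) * x n ^ (-(1 / 2 + ξ))) := by
      rw [← e1, ← Real.rpow_add (hx n)]; ring_nf
    rw [e2, e1]
    simp only [B, p]
    ring
  have hcol : ∀ n K, ∑ k ∈ range K, w k * B k n ≤ p n := by
    intro n K
    have hexp : ∑ k ∈ range (K + 1), (ξ * Real.log (x n)) ^ k / k.factorial ≤ x n ^ ξ := by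
      rw [Real.rpow_def_of_pos (hx n), mul_comm (Real.log _)]
      exact Real.sum_le_exp_of_nonneg (hl n) _
    have hw : ∀ k, 0 ≤ w k := fun k => by simp only [w]; split_ifs <;> norm_num
    refine (sum_le_sum_of_subset_of_nonneg (range_subset_range.2 K.le_succ)
      fun k _ _ => mul_nonneg (hw k) (hB k n)).trans ?_
    have e : ∑ k ∈ range (K + 1), w k * B k n =
        (1 + ∑ k ∈ range (K + 1), (ξ * Real.log (x n)) ^ k / k.factorial) / 2 *
          x n ^ (-(1 / 2 + ξ)) := by
      rw [sum_range_succ', sum_range_succ']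
      simp only [w, B, Nat.succ_ne_zero, if_false, if_true, pow_zero, Nat.factorial_zero,
        Nat.cast_one, div_one, ← mul_sum, ← sum_mul]
      ring
    rw [e]
    have := (Real.rpow_pos_of_pos (hx n) (-(1 / 2 + ξ))).le
    simp only [p]
    gcongr
  have hrow : ∀ k N, ∑ n ∈ range N, B k n * p n ≤ C * w k := by
    intro k N
    simp only [hBp, ← mul_sum, sum_add_distrib]
    rcases eq_or_ne k 0 with rfl | hk
    · have h1 := (summable_zetaR (σ := 1 + ξ) (by linarith)).sum_le_tsum (range N)
        (fun n _ => by positivity)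
      have h2 := (summable_zetaR (σ := 1 + 2 * ξ) (by linarith)).sum_le_tsum (range N)
        (fun n _ => by positivity)
      simp only [pow_zero, Nat.factorial_zero, Nat.cast_one, div_one, one_mul, w, if_true, x]
      unfold zetaR at hCdef
      linarith
    · have hmono : ∀ s : ℝ, ∑ n ∈ range N, (ξ * Real.log (x n)) ^ k / k.factorial * x n ^ s ≤
          ∑ n ∈ range N, (ξ * Real.log ((n : ℝ) + 1 + 1)) ^ k / k.factorial *
            ((n : ℝ) + 1 + 1) ^ s := by
        intro s
        refine (sum_le_sum_of_subset_of_nonneg (range_subset_range.2 N.le_succ)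
          fun n _ _ => ?_).trans ?_
        · have := hl n
          have := (hx n).le
          positivity
        · rw [sum_range_succ']
          simp [x, hk]
      have h1 := (hmono _).trans (sum_log_pow_le_one hk hbig N)
      have h2 := (hmono _).trans (sum_log_pow_double_le hk hξ N)
      simp only [w, hk, if_false]
      linarith
  let z : ℕ → ℕ → ℂ := fun k n => ((ξ ^ k / k.factorial : ℝ) : ℂ) *
    (a n * ((-Real.log ((n : ℝ) + 1) : ℝ) : ℂ) ^ k * ((n : ℂ) + 1) ^ (-c))
  have hz : ∀ k n, ‖z k n‖ = B k n * ‖a n‖ := by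
    intro k n
    have hcpow : ‖((n : ℂ) + 1) ^ (-c)‖ = x n ^ (-(1 / 2 + ξ)) := by
      have := Complex.norm_cpow_eq_rpow_re_of_pos (hx n) (-c)
      simpa [x, hc] using this
    have hlog : 0 ≤ Real.log (x n) := Real.log_nonneg (by simp [x])
    simp only [z, norm_mul, norm_pow, hcpow, Complex.norm_real, Real.norm_eq_abs, abs_neg, B]
    rw [abs_of_nonneg (show 0 ≤ ξ ^ k / (k.factorial : ℝ) by positivity),
      show |Real.log ((n : ℝ) + 1)| = Real.log (x n) from abs_of_nonneg hlog]
    ring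
  have hmain := tsum_norm_tsum_sq_le hC hz ha
    (schur_test_finite hB hp hC hcol hrow fun n => ‖a n‖)
  refine le_trans (le_of_eq (tsum_congr fun k => ?_)) hmain
  simp only [z]
  rw [tsum_mul_left, norm_mul, mul_pow, Complex.norm_real, Real.norm_eq_abs, sq_abs]
  ring
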